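/- arXiv:1805.05876 — 2 statements merged into one kernel-verified Lean document; each statement's English description precedes it below -/
import Mathlib

section
/- For i = 1, 2 let n_i ∈ ℝ³ with ‖n_i‖ = 1, d_i ≠ 0, Π_i = d_i·n_i, and let {n⊥_{i,1}, n⊥_{i,2}, n_i} be orthonormal with R_{Π,i} = [n⊥_{i,1}, n⊥_{i,2}, n_i] a rotation matrix. Let g, P₁, V₁, P_k ∈ ℝ³, δt ∈ ℝ, let R₁ be a rotation matrix, and let A_i, B_i ∈ ℝ³ˣ³ be arbitrary. Over the joint state (orientation, gyro bias, velocity, accel bias, position, Π₁, Π₂) of dimension 21, define the block row of plane i as M_i = [Γ_{π1,i}, A_i, −δt·n_in_iᵀ, B_i, −n_in_iᵀ, then Γ_{π4,i} at the Π_i block and 0₃ₓ₃ at the other plane block], with Γ_{π1,i} = ((d_i − n_iᵀP_k)⌊n_i×⌋ − n_in_iᵀ⌊(P₁ + V₁δt − ½δt²g − P_k)×⌋)R₁ and Γ_{π4,i} = ((d_i − n_iᵀP_k)I₃ − n_iP_kᵀ + 2(n_iᵀP_k)n_in_iᵀ)/d_i. Let N_Π ∈ ℝ²¹ˣ⁵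 have: column 1 = (R₁ᵀg; 0; −⌊V₁×⌋g; 0; −⌊P₁×⌋g; −⌊Π₁×⌋g; −⌊Π₂×⌋g); columns 2–4 given by stacked blocks (0; 0; 0; 0; R_{Π,1}; n₁·e₃ᵀ·R_{Π,1}ᵀR_{Π,1}; n₂·e₃ᵀ·R_{Π,2}ᵀR_{Π,1}); column 5 = (0; 0; ⌊n₁×⌋n₂; 0; 0; 0; 0). Then M_1·N_Π = 0 and M_2·N_Π = 0. Hence the linearized aided INS with two non-parallel plane features has at least 5 unobservable directions, the fifth being translation along the planes' intersection line. -/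
open Matrix

noncomputable section

abbrev V3 : Type := Fin 3 → ℝ
abbrev M3 : Type := Matrix (Fin 3) (Fin 3) ℝ

/-- The skew-symmetric cross-product matrix `⌊v×⌋`. -/
def skew (v : V3) : M3 :=
  !![0, -(v 2), v 1; v 2, 0, -(v 0); -(v 1), v 0, 0]

/-- `R` is a rotation matrix: `RᵀR = I₃` and `det R = 1`. -/
def IsRot (R : M3) : Prop := Rᵀ * R = 1 ∧ R.det = 1

/-- Euclidean norm on `ℝ³`. -/
def norm3 (v : V3) : ℝ := Real.sqrt (v ⬝ᵥ v)

def e1 : V3 := ![1, 0, 0]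
def e2 : V3 := ![0, 1, 0]
def e3 : V3 := ![0, 0, 1]

/-- The 3×3 matrix with the given columns. -/
def cols3 (a b c : V3) : M3 := Matrix.of fun i j => ![a i, b i, c i] j

/-- The 3×3 matrix with the given rows. -/
def rows3 (a b c : V3) : M3 := Matrix.of ![a, b, c]

/-- 21-dimensional joint state index (seven 3-dimensional blocks). -/
abbrev S21 : Type := Fin 3 ⊕ Fin 3 ⊕ Fin 3 ⊕ Fin 3 ⊕ Fin 3 ⊕ Fin 3 ⊕ Fin 3

/-- The 3×21 block row `[A B C D E F G]`. -/
def row7 (A B C D E F G : M3) : Matrix (Fin 3) S21 ℝ :=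
  Matrix.of fun i =>
    Sum.elim (fun j => A i j) (Sum.elim (fun j => B i j) (Sum.elim (fun j => C i j)
      (Sum.elim (fun j => D i j) (Sum.elim (fun j => E i j)
        (Sum.elim (fun j => F i j) (fun j => G i j))))))

/-- The stacked vector `(a; b; c; d; e; f; g)` in ℝ²¹. -/
def col7v (a b c d e f g : V3) : S21 → ℝ :=
  Sum.elim a (Sum.elim b (Sum.elim c (Sum.elim d (Sum.elim e (Sum.elim f g)))))

/-- The 21×3 stacked blocks `(A; B; C; D; E; F; G)`. -/
def stack7m (A B C D E F G : M3) : Matrix S21 (Fin 3) ℝ :=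
  Matrix.of (Sum.elim (fun i => A i) (Sum.elim (fun i => B i) (Sum.elim (fun i => C i)
    (Sum.elim (fun i => D i) (Sum.elim (fun i => E i)
      (Sum.elim (fun i => F i) (fun i => G i)))))))


theorem dotProduct_self_of_norm3_eq_one {n : V3} (hn : norm3 n = 1) : n ⬝ᵥ n = 1 :=
  Real.sqrt_eq_one.mp hn

theorem skew_mulVec (v w : V3) : skew v *ᵥ w = crossProduct v w := by
  ext i
  fin_cases i <;> simp [skew, cross_apply, mulVec, dotProduct, Fin.sum_univ_three] <;> ring

theorem cols3_mulVec_e3 (a b c : V3) : cols3 a b c *ᵥ e3 = c := by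
  ext i
  simp [cols3, e3, mulVec, dotProduct, Fin.sum_univ_three]

theorem vecMulVec_mulVec_eq_smul (u v w : V3) : vecMulVec u v *ᵥ w = (v ⬝ᵥ w) • u := by
  ext i
  simp [vecMulVec_mulVec, mul_comm]

theorem row7_mulVec_col7v (A B C D E F G : M3) (a b c d e f g : V3) :
    row7 A B C D E F G *ᵥ col7v a b c d e f g =
      A *ᵥ a + B *ᵥ b + C *ᵥ c + D *ᵥ d + E *ᵥ e + F *ᵥ f + G *ᵥ g := by
  ext i
  simp only [row7, col7v, mulVec, dotProduct, Fintype.sum_sum_type, Sum.elim_inl, Sum.elim_inr,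
    of_apply, Pi.add_apply]
  ring

theorem row7_mul_stack7m (A B C D E F G A' B' C' D' E' F' G' : M3) :
    row7 A B C D E F G * stack7m A' B' C' D' E' F' G' =
      A * A' + B * B' + C * C' + D * D' + E * E' + F * F' + G * G' := by
  ext i j
  simp only [row7, stack7m, mul_apply, Fintype.sum_sum_type, Sum.elim_inl, Sum.elim_inr,
    of_apply, Matrix.add_apply]
  ring

/-- The Jacobian of the plane measurement with respect to the closest-point feature. -/
def planeJacobian (n Pk : V3) (d : ℝ) : M3 :=
  d⁻¹ • ((d - n ⬝ᵥ Pk) • (1 : M3) - vecMulVec n Pk + (2 * (n ⬝ᵥ Pk)) • vecMulVec n n)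

theorem planeJacobian_mulVec (n Pk v : V3) (d : ℝ) :
    planeJacobian n Pk d *ᵥ v =
      d⁻¹ • ((d - n ⬝ᵥ Pk) • v - (Pk ⬝ᵥ v) • n + (2 * (n ⬝ᵥ Pk) * (n ⬝ᵥ v)) • n) := by
  simp only [planeJacobian, smul_mulVec, add_mulVec, sub_mulVec, one_mulVec,
    vecMulVec_mulVec_eq_smul, smul_smul]

theorem planeJacobian_mulVec_normal {n : V3} (hn : n ⬝ᵥ n = 1) (Pk : V3) {d : ℝ} (hd : d ≠ 0) :
    planeJacobian n Pk d *ᵥ n = n := by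
  rw [planeJacobian_mulVec, hn, dotProduct_comm Pk n, ← sub_smul, ← add_smul, smul_smul]
  rw [show d⁻¹ * (d - n ⬝ᵥ Pk - n ⬝ᵥ Pk + 2 * (n ⬝ᵥ Pk) * 1) = 1 by field_simp; ring, one_smul]

/-- A rotation about gravity leaves the plane measurement unchanged. -/
theorem plane_gravity_direction (n g P V Pk : V3) {d : ℝ} (hd : d ≠ 0) (δt : ℝ) {R : M3}
    (hR : IsRot R) :
    (((d - n ⬝ᵥ Pk) • skew n
        - vecMulVec n n * skew (P + δt • V - (δt ^ 2 / 2) • g - Pk)) * R) *ᵥ (Rᵀ *ᵥ g)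
      + ((-δt) • vecMulVec n n) *ᵥ (-(skew V *ᵥ g)) + (-(vecMulVec n n)) *ᵥ (-(skew P *ᵥ g))
      + planeJacobian n Pk d *ᵥ (-(skew (d • n) *ᵥ g)) = 0 := by
  have hRR : R * Rᵀ = 1 := mul_eq_one_comm.mp hR.1
  have hcyc : Pk ⬝ᵥ crossProduct n g = -(n ⬝ᵥ crossProduct Pk g) := by
    rw [triple_product_permutation, ← cross_anticomm, dotProduct_neg]
  rw [mulVec_mulVec, Matrix.mul_assoc, hRR, Matrix.mul_one, sub_mulVec, ← mulVec_mulVec]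
  simp only [skew_mulVec, smul_mulVec, neg_mulVec, mulVec_neg, vecMulVec_mulVec_eq_smul,
    planeJacobian_mulVec, map_add, map_sub, map_smul, LinearMap.add_apply, LinearMap.sub_apply,
    LinearMap.smul_apply, cross_self, dotProduct_add, dotProduct_sub, dotProduct_smul,
    dot_self_cross, hcyc]
  ext i
  simp only [Pi.add_apply, Pi.sub_apply, Pi.neg_apply, Pi.smul_apply, smul_eq_mul, Pi.zero_apply,
    dotProduct_zero]
  field_simp
  ring

/-- A global translation leaves the plane measurement unchanged. -/
theorem plane_translation_directions {n : V3} (hn : n ⬝ᵥ n = 1) (Pk : V3) {d : ℝ} (hd : d ≠ 0)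
    {Q : M3} (hQ : Q *ᵥ e3 = n) (S : M3) :
    -(vecMulVec n n) * S + planeJacobian n Pk d * (vecMulVec n e3 * (Qᵀ * S)) = 0 := by
  rw [← Matrix.mul_assoc, ← Matrix.mul_assoc, mul_vecMulVec, planeJacobian_mulVec_normal hn Pk hd,
    vecMulVec_mul, vecMul_transpose, hQ, Matrix.neg_mul, neg_add_cancel]

/-- the linearized aided INS with two plane features has the 5 listed
unobservable directions (the fifth being translation along the planes' intersection). -/
theorem two_planes_unobservable_directions
    (n₁ n₂ np11 np12 np21 np22 g P₁ V₁ Pk : V3) (d₁ d₂ δt : ℝ)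
    (R₁ : M3) (hR₁ : IsRot R₁)
    (hn₁ : norm3 n₁ = 1) (hn₂ : norm3 n₂ = 1) (hd₁ : d₁ ≠ 0) (hd₂ : d₂ ≠ 0)
    (h1a : np11 ⬝ᵥ np11 = 1) (h1b : np12 ⬝ᵥ np12 = 1) (h1c : np11 ⬝ᵥ np12 = 0)
    (h1d : np11 ⬝ᵥ n₁ = 0) (h1e : np12 ⬝ᵥ n₁ = 0)
    (h2a : np21 ⬝ᵥ np21 = 1) (h2b : np22 ⬝ᵥ np22 = 1) (h2c : np21 ⬝ᵥ np22 = 0)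
    (h2d : np21 ⬝ᵥ n₂ = 0) (h2e : np22 ⬝ᵥ n₂ = 0)
    (hRPi1 : IsRot (cols3 np11 np12 n₁)) (hRPi2 : IsRot (cols3 np21 np22 n₂))
    (A₁ B₁ A₂ B₂ : M3) :
    let cp₁ : V3 := d₁ • n₁
    let cp₂ : V3 := d₂ • n₂
    let RPi1 : M3 := cols3 np11 np12 n₁
    let RPi2 : M3 := cols3 np21 np22 n₂
    let Γπ11 : M3 := ((d₁ - n₁ ⬝ᵥ Pk) • skew n₁
        - vecMulVec n₁ n₁ * skew (P₁ + δt • V₁ - (δt ^ 2 / 2) • g - Pk)) * R₁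
    let Γπ12 : M3 := ((d₂ - n₂ ⬝ᵥ Pk) • skew n₂
        - vecMulVec n₂ n₂ * skew (P₁ + δt • V₁ - (δt ^ 2 / 2) • g - Pk)) * R₁
    let Γπ41 : M3 := d₁⁻¹ • ((d₁ - n₁ ⬝ᵥ Pk) • (1 : M3) - vecMulVec n₁ Pk
        + (2 * (n₁ ⬝ᵥ Pk)) • vecMulVec n₁ n₁)
    let Γπ42 : M3 := d₂⁻¹ • ((d₂ - n₂ ⬝ᵥ Pk) • (1 : M3) - vecMulVec n₂ Pk
        + (2 * (n₂ ⬝ᵥ Pk)) • vecMulVec n₂ n₂)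
    let M₁ : Matrix (Fin 3) S21 ℝ :=
      row7 Γπ11 A₁ ((-δt) • vecMulVec n₁ n₁) B₁ (-(vecMulVec n₁ n₁)) Γπ41 0
    let M₂ : Matrix (Fin 3) S21 ℝ :=
      row7 Γπ12 A₂ ((-δt) • vecMulVec n₂ n₂) B₂ (-(vecMulVec n₂ n₂)) 0 Γπ42
    let NPi : Matrix S21 (Fin 1 ⊕ Fin 3 ⊕ Fin 1) ℝ :=
      Matrix.of fun s => Sum.elim
        (fun _ : Fin 1 =>
          col7v (R₁ᵀ *ᵥ g) 0 (-(skew V₁ *ᵥ g)) 0 (-(skew P₁ *ᵥ g))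
            (-(skew cp₁ *ᵥ g)) (-(skew cp₂ *ᵥ g)) s)
        (Sum.elim
          (fun j : Fin 3 => stack7m 0 0 0 0 RPi1 (vecMulVec n₁ e3 * (RPi1ᵀ * RPi1))
            (vecMulVec n₂ e3 * (RPi2ᵀ * RPi1)) s j)
          (fun _ : Fin 1 => col7v 0 0 (skew n₁ *ᵥ n₂) 0 0 0 0 s))
    M₁ * NPi = 0 ∧ M₂ * NPi = 0 := by
  intro cp₁ cp₂ RPi1 RPi2 Γπ11 Γπ12 Γπ41 Γπ42 M₁ M₂ NPi
  have hn₁' := dotProduct_self_of_norm3_eq_one hn₁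
  have hn₂' := dotProduct_self_of_norm3_eq_one hn₂
  have key (M : Matrix (Fin 3) S21 ℝ)
      (hg : M *ᵥ col7v (R₁ᵀ *ᵥ g) 0 (-(skew V₁ *ᵥ g)) 0 (-(skew P₁ *ᵥ g))
        (-(skew cp₁ *ᵥ g)) (-(skew cp₂ *ᵥ g)) = 0)
      (ht : M * stack7m 0 0 0 0 RPi1 (vecMulVec n₁ e3 * (RPi1ᵀ * RPi1))
        (vecMulVec n₂ e3 * (RPi2ᵀ * RPi1)) = 0)
      (hv : M *ᵥ col7v 0 0 (skew n₁ *ᵥ n₂) 0 0 0 0 = 0) : M * NPi = 0 := by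
    ext i (k | k | k)
    · exact congrFun hg i
    · exact congrFun (congrFun ht i) k
    · exact congrFun hv i
  constructor
  · apply key
    · simp only [M₁, row7_mulVec_col7v, mulVec_zero, zero_mulVec, add_zero]
      exact plane_gravity_direction n₁ g P₁ V₁ Pk hd₁ δt hR₁
    · simp only [M₁, row7_mul_stack7m, Matrix.mul_zero, Matrix.zero_mul, add_zero, zero_add]
      exact plane_translation_directions hn₁' Pk hd₁ (cols3_mulVec_e3 np11 np12 n₁) RPi1
    · simp [M₁, row7_mulVec_col7v, neg_mulVec, smul_mulVec, vecMulVec_mulVec_eq_smul, skew_mulVec]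
  · apply key
    · simp only [M₂, row7_mulVec_col7v, mulVec_zero, zero_mulVec, add_zero]
      exact plane_gravity_direction n₂ g P₁ V₁ Pk hd₂ δt hR₁
    · simp only [M₂, row7_mul_stack7m, Matrix.mul_zero, Matrix.zero_mul, add_zero, zero_add]
      exact plane_translation_directions hn₂' Pk hd₂ (cols3_mulVec_e3 np21 np22 n₂) RPi1
    · simp [M₂, row7_mulVec_col7v, neg_mulVec, smul_mulVec, vecMulVec_mulVec_eq_smul, skew_mulVec]
end
end

section
/- Let r, δt, g₀, θ, φ ∈ ℝ with r ≠ 0 and cosφ ≠ 0, and set g = (0, 0, −g₀), b = (cosθcosφ, sinθcosφ, sinφ), b⊥₁ = (−sinθ, cosθ, 0), b⊥₂ = (−cosθsinφ, −sinθsinφ, cosφ), and P_f = r·b. Let P₁, V₁ ∈ ℝ³, let R₁ be a rotation matrix, and let Γ₂, Γ₄ ∈ ℝ³ˣ³ be arbitrary. Define the 3×18 block matrix M = [Γ₁, Γ₂, −δtI₃, Γ₄, −I₃, b, r·cosφ·b⊥₁, r·b⊥₂] with Γ₁ = ⌊(P_f − P₁ − V₁δt + ½δt²g)×⌋R₁,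 and the 18×4 matrix N_rb whose first column is (R₁ᵀg; 0; −⌊V₁×⌋g; 0; −⌊P₁×⌋g; 0; −g₀; 0) (the last three entries being the scalar r-, θ-, φ-rows) and whose remaining three columns are (0; 0; 0; 0; I₃; bᵀ; b⊥₁ᵀ/(r·cosφ); b⊥₂ᵀ/r) (stacked blocks/rows). Then M·N_rb = 0. Hence in the spherical (range–bearing) parameterization of a point feature, the linearized aided INS has the same 4 unobservable directions (rotation about gravity and global translation) as in the Cartesian parameterization. -/
open Matrix

noncomputable section

/-- 18-dimensional aided-INS state index:
(orientation, gyro bias, velocity, accel bias, position, feature). -/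
abbrev S18 : Type := Fin 3 ⊕ Fin 3 ⊕ Fin 3 ⊕ Fin 3 ⊕ Fin 3 ⊕ Fin 3

/-- The 3×18 block row `[A B C D E F]`. -/
def row6 (A B C D E F : M3) : Matrix (Fin 3) S18 ℝ :=
  Matrix.of fun i =>
    Sum.elim (fun j => A i j) (Sum.elim (fun j => B i j) (Sum.elim (fun j => C i j)
      (Sum.elim (fun j => D i j) (Sum.elim (fun j => E i j) (fun j => F i j)))))

/-- The stacked vector `(a; b; c; d; e; f)` in ℝ¹⁸. -/
def col6 (a b c d e f : V3) : S18 → ℝ :=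
  Sum.elim a (Sum.elim b (Sum.elim c (Sum.elim d (Sum.elim e f))))

/-- The 18×3 stacked blocks `(A; B; C; D; E; F)`. -/
def stack6 (A B C D E F : M3) : Matrix S18 (Fin 3) ℝ :=
  Matrix.of (Sum.elim (fun i => A i) (Sum.elim (fun i => B i) (Sum.elim (fun i => C i)
    (Sum.elim (fun i => D i) (Sum.elim (fun i => E i) (fun i => F i))))))

theorem row6_mulVec_col6 (A B C D E F : M3) (a b c d e f : V3) :
    row6 A B C D E F *ᵥ col6 a b c d e f =
      A *ᵥ a + B *ᵥ b + C *ᵥ c + D *ᵥ d + E *ᵥ e + F *ᵥ f := by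
  ext i
  simp [row6, col6, mulVec, dotProduct, Fintype.sum_sum_type, add_assoc]

theorem row6_mul_stack6 (A B C D E F A' B' C' D' E' F' : M3) :
    row6 A B C D E F * stack6 A' B' C' D' E' F' =
      A * A' + B * B' + C * C' + D * D' + E * E' + F * F' := by
  ext i j
  simp [row6, stack6, mul_apply, Fintype.sum_sum_type, add_assoc]

theorem skew_add (v w : V3) : skew (v + w) = skew v + skew w := by
  ext i j
  fin_cases i <;> fin_cases j <;> simp [skew] <;> ring

theorem skew_smul (c : ℝ) (v : V3) : skew (c • v) = c • skew v := by
  ext i j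
  fin_cases i <;> fin_cases j <;> simp [skew]

theorem skew_sub (v w : V3) : skew (v - w) = skew v - skew w := by
  ext i j
  fin_cases i <;> fin_cases j <;> simp [skew] <;> ring

theorem skew_mulVec_self (v : V3) : skew v *ᵥ v = 0 := by
  ext i
  fin_cases i <;> simp [skew, mulVec, dotProduct, Fin.sum_univ_three] <;> ring

theorem IsRot.mul_transpose {R : M3} (hR : IsRot R) : R * Rᵀ = 1 :=
  mul_eq_one_comm.mp hR.1

/-- Rotating the feature about gravity changes only its azimuth `θ`. -/
theorem skew_spherical_mulVec_gravity (r θ φ g₀ : ℝ) (b₂ : V3) :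
    skew (r • ![Real.cos θ * Real.cos φ, Real.sin θ * Real.cos φ, Real.sin φ]) *ᵥ ![0, 0, -g₀] +
      cols3 ![Real.cos θ * Real.cos φ, Real.sin θ * Real.cos φ, Real.sin φ]
        ((r * Real.cos φ) • ![-Real.sin θ, Real.cos θ, 0]) b₂ *ᵥ ![0, -g₀, 0] = 0 := by
  ext i
  fin_cases i <;> simp [skew, cols3] <;> ring

theorem cols3_smul_mul_rows3_inv_smul (a b c : V3) {s t : ℝ} (hs : s ≠ 0) (ht : t ≠ 0) :
    cols3 a (s • b) (t • c) * rows3 a (s⁻¹ • b) (t⁻¹ • c) = cols3 a b c * rows3 a b c := by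
  ext i j
  simp [cols3, rows3, mul_apply, Fin.sum_univ_three]
  field_simp

theorem spherical_frame_mul_transpose (θ φ : ℝ) :
    cols3 ![Real.cos θ * Real.cos φ, Real.sin θ * Real.cos φ, Real.sin φ]
        ![-Real.sin θ, Real.cos θ, 0]
        ![-(Real.cos θ * Real.sin φ), -(Real.sin θ * Real.sin φ), Real.cos φ] *
      rows3 ![Real.cos θ * Real.cos φ, Real.sin θ * Real.cos φ, Real.sin φ]
        ![-Real.sin θ, Real.cos θ, 0]
        ![-(Real.cos θ * Real.sin φ), -(Real.sin θ * Real.sin φ), Real.cos φ] = 1 := by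
  have hθ := Real.sin_sq_add_cos_sq θ
  have hφ := Real.sin_sq_add_cos_sq φ
  ext i j
  fin_cases i <;> fin_cases j <;>
    simp [cols3, rows3, mul_apply, Fin.sum_univ_three] <;> grind

/-- in the spherical (range–bearing) point parameterization, the
linearized aided INS has the same 4 unobservable directions (rotation about gravity
and global translation). -/
theorem spherical_point_unobservable_directions
    (b bp1 bp2 g P₁ V₁ Pf : V3) (r θ φ δt g₀ : ℝ)
    (hr : r ≠ 0) (hcos : Real.cos φ ≠ 0)
    (hg : g = ![0, 0, -g₀])
    (hb : b = ![Real.cos θ * Real.cos φ, Real.sin θ * Real.cos φ, Real.sin φ])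
    (hbp1 : bp1 = ![-Real.sin θ, Real.cos θ, 0])
    (hbp2 : bp2 = ![-(Real.cos θ * Real.sin φ), -(Real.sin θ * Real.sin φ), Real.cos φ])
    (hPf : Pf = r • b)
    (R₁ : M3) (hR₁ : IsRot R₁) (Γ₂ Γ₄ : M3) :
    let Γ₁ : M3 := skew (Pf - P₁ - δt • V₁ + (δt ^ 2 / 2) • g) * R₁
    let Jpt : M3 := cols3 b ((r * Real.cos φ) • bp1) (r • bp2)
    let M : Matrix (Fin 3) S18 ℝ :=
      row6 Γ₁ Γ₂ ((-δt) • (1 : M3)) Γ₄ (-1) Jpt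
    let Nrb : Matrix S18 (Fin 1 ⊕ Fin 3) ℝ :=
      Matrix.of fun s => Sum.elim
        (fun _ : Fin 1 =>
          col6 (R₁ᵀ *ᵥ g) 0 (-(skew V₁ *ᵥ g)) 0 (-(skew P₁ *ᵥ g)) ![0, -g₀, 0] s)
        (fun j : Fin 3 => stack6 0 0 0 0 1
          (rows3 b ((r * Real.cos φ)⁻¹ • bp1) (r⁻¹ • bp2)) s j)
    M * Nrb = 0 := by
  intro Γ₁ Jpt M Nrb
  have hrot : M *ᵥ col6 (R₁ᵀ *ᵥ g) 0 (-(skew V₁ *ᵥ g)) 0 (-(skew P₁ *ᵥ g)) ![0, -g₀, 0] = 0 := by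
    have hfeature : skew Pf *ᵥ g + Jpt *ᵥ ![0, -g₀, 0] = 0 := by
      simp only [Jpt, hPf, hb, hbp1, hg]
      exact skew_spherical_mulVec_gravity r θ φ g₀ _
    have hΓ₁ : Γ₁ *ᵥ (R₁ᵀ *ᵥ g) = skew Pf *ᵥ g - skew P₁ *ᵥ g - δt • (skew V₁ *ᵥ g) := by
      simp only [Γ₁, mulVec_mulVec, Matrix.mul_assoc, hR₁.mul_transpose, Matrix.mul_one,
        skew_add, skew_sub, skew_smul, add_mulVec, sub_mulVec, smul_mulVec, skew_mulVec_self,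
        smul_zero, add_zero]
    rw [row6_mulVec_col6, hΓ₁, eq_neg_of_add_eq_zero_right hfeature]
    simp only [mulVec_zero, smul_mulVec, one_mulVec, neg_mulVec, neg_smul, smul_neg, neg_neg]
    abel
  have htrans : M * stack6 0 0 0 0 1
      (rows3 b ((r * Real.cos φ)⁻¹ • bp1) (r⁻¹ • bp2)) = 0 := by
    have hJ : Jpt * rows3 b ((r * Real.cos φ)⁻¹ • bp1) (r⁻¹ • bp2) = 1 := by
      simp only [Jpt]
      rw [cols3_smul_mul_rows3_inv_smul _ _ _ (mul_ne_zero hr hcos) hr, hb, hbp1, hbp2,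
        spherical_frame_mul_transpose]
    rw [row6_mul_stack6, hJ]
    simp
  ext i (j | j)
  · exact congrFun hrot i
  · exact congrFun (congrFun htrans i) j
end
end
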